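/- arXiv:2505.09968 — 4 statements merged into one kernel-verified Lean document; each statement's English description precedes it below -/
import Mathlib

section
/- Let r, γ be real parameters with 0 < γ ≤ r. Suppose x, y : ℝ → ℝ are differentiable functions satisfying, for all t ≥ 0, x'(t) = x(t)(1 − x(t)) − x(t)y(t) and y'(t) = γ x(t) y(t) − r y(t), and suppose x(t) > 0 and y(t) ≥ 0 for all t ≥ 0. Then (x(t), y(t)) tends to the equilibrium point E₁ = (1, 0) as t → ∞. -/
open Filter Topology Set

/-- A differentiable function that is nonincreasing and bounded below on `[0, ∞)` converges. -/
lemma exists_tendsto_of_hasDerivAt_nonpos {f f' : ℝ → ℝ} {b : ℝ}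
    (hf : ∀ t, 0 ≤ t → HasDerivAt f (f' t) t) (hf' : ∀ t, 0 ≤ t → f' t ≤ 0)
    (hb : ∀ t, 0 ≤ t → b ≤ f t) : ∃ l, Tendsto f atTop (𝓝 l) := by
  have hanti : AntitoneOn f (Ici 0) := by
    refine antitoneOn_of_deriv_nonpos (convex_Ici 0)
      (fun t ht => (hf t ht).continuousAt.continuousWithinAt) ?_ ?_
    · intro t ht
      exact (hf t (interior_subset ht)).differentiableAt.differentiableWithinAt
    · intro t ht
      rw [(hf t (interior_subset ht)).deriv]
      exact hf' t (interior_subset ht)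
  have hg : Antitone fun t => f (max t 0) := fun s t hst =>
    hanti (le_max_right s 0) (le_max_right t 0) (max_le_max_right 0 hst)
  have hbdd : BddBelow (range fun t => f (max t 0)) := by
    refine ⟨b, ?_⟩
    rintro _ ⟨t, rfl⟩
    exact hb _ (le_max_right t 0)
  refine ⟨_, (tendsto_atTop_ciInf hg hbdd).congr' ?_⟩
  filter_upwards [eventually_ge_atTop (0 : ℝ)] with t ht
  rw [max_eq_left ht]

/-- If a function and its derivative both converge at infinity, the derivative tends to zero. -/
lemma eq_zero_of_tendsto_of_tendsto_deriv {f : ℝ → ℝ} {l m : ℝ} (hf : Differentiable ℝ f)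
    (hm : Tendsto f atTop (𝓝 m)) (hl : Tendsto (deriv f) atTop (𝓝 l)) : l = 0 := by
  have hmvt : ∀ t : ℝ, ∃ c ∈ Ioo t (t + 1), deriv f c = f (t + 1) - f t := by
    intro t
    obtain ⟨c, hc, h⟩ := exists_deriv_eq_slope f (lt_add_one t) hf.continuous.continuousOn
      hf.differentiableOn
    exact ⟨c, hc, by rw [h]; simp⟩
  choose c hc hfc using hmvt
  have hctop : Tendsto c atTop atTop := tendsto_atTop_mono (fun t => (hc t).1.le) tendsto_id
  have hdiff : Tendsto (fun t => f (t + 1) - f t) atTop (𝓝 (m - m)) :=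
    (hm.comp (tendsto_atTop_add_const_right _ 1 tendsto_id)).sub hm
  rw [sub_self] at hdiff
  exact tendsto_nhds_unique ((hl.comp hctop).congr hfc) hdiff

/-- A real-valued function converges as soon as its cube does. -/
lemma exists_tendsto_of_tendsto_cube {α : Type*} {F : Filter α} {f : α → ℝ} {l : ℝ}
    (h : Tendsto (fun t => f t ^ 3) F (𝓝 l)) : ∃ a, Tendsto f F (𝓝 a) := by
  have hodd : Odd 3 := by decide
  have htop : Tendsto (fun s : ℝ => s ^ 3) atTop atTop := tendsto_pow_atTop (by norm_num)
  have hbot : Tendsto (fun s : ℝ => s ^ 3) atBot atBot :=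
    (tendsto_neg_atTop_atBot.comp (htop.comp tendsto_neg_atBot_atTop)).congr fun s => by
      simp [hodd.neg_pow]
  have hsurj : Function.Surjective fun s : ℝ => s ^ 3 :=
    (continuous_pow 3).surjective htop hbot
  have hemb : IsEmbedding fun s : ℝ => s ^ 3 :=
    (hodd.strictMono_pow (R := ℝ)).isEmbedding_of_ordConnected
      (by rw [hsurj.range_eq]; exact ordConnected_univ)
  obtain ⟨a, rfl⟩ := hsurj l
  exact ⟨a, hemb.tendsto_nhds_iff.2 h⟩

/-- Continuous phytoplankton–zooplankton model, case `0 < γ ≤ r`: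
every positive solution converges to the equilibrium `E₁ = (1, 0)`. -/
theorem continuous_model_global_stability_E1
    (r γ : ℝ) (hγ : 0 < γ) (hγr : γ ≤ r)
    (x y : ℝ → ℝ) (hx : Differentiable ℝ x) (hy : Differentiable ℝ y)
    (hxode : ∀ t : ℝ, 0 ≤ t → deriv x t = x t * (1 - x t) - x t * y t)
    (hyode : ∀ t : ℝ, 0 ≤ t → deriv y t = γ * x t * y t - r * y t)
    (hxpos : ∀ t : ℝ, 0 ≤ t → 0 < x t)
    (hynonneg : ∀ t : ℝ, 0 ≤ t → 0 ≤ y t) :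
    Filter.Tendsto (fun t => (x t, y t)) Filter.atTop (nhds ((1 : ℝ), (0 : ℝ))) := by
  have hx' : ∀ t, 0 ≤ t → HasDerivAt x (x t * (1 - x t) - x t * y t) t := fun t ht =>
    hxode t ht ▸ (hx t).hasDerivAt
  have hy' : ∀ t, 0 ≤ t → HasDerivAt y (γ * x t * y t - r * y t) t := fun t ht =>
    hyode t ht ▸ (hy t).hasDerivAt
  -- The Lyapunov function `V = γ (x - 1 - log x) + y`.
  set V : ℝ → ℝ := fun t => γ * (x t - 1 - Real.log (x t)) + y t with hV
  have hV' : ∀ t, 0 ≤ t → HasDerivAt V (-(γ * (x t - 1) ^ 2) - (r - γ) * y t) t := by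
    intro t ht
    have hne := (hxpos t ht).ne'
    refine (((((hx' t ht).sub_const 1).sub ((hx' t ht).log hne)).const_mul γ).add
      (hy' t ht)).congr_deriv ?_
    field_simp
    ring
  have hVnonneg : ∀ t, 0 ≤ t → 0 ≤ V t := by
    intro t ht
    have hlog := Real.log_le_sub_one_of_pos (hxpos t ht)
    exact add_nonneg (mul_nonneg hγ.le (by linarith)) (hynonneg t ht)
  have hV'nonpos : ∀ t, 0 ≤ t → -(γ * (x t - 1) ^ 2) - (r - γ) * y t ≤ 0 := by
    intro t ht
    have h₁ : 0 ≤ γ * (x t - 1) ^ 2 := by positivity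
    have h₂ := mul_nonneg (sub_nonneg.2 hγr) (hynonneg t ht)
    linarith
  obtain ⟨L, hL⟩ := exists_tendsto_of_hasDerivAt_nonpos hV' hV'nonpos hVnonneg
  -- Since `x' ≤ 1`, the function `γ (x - 1) ^ 3 + 3 V` is nonincreasing as well.
  obtain ⟨X, hX⟩ : ∃ X, Tendsto x atTop (𝓝 X) := by
    have hW' : ∀ t, 0 ≤ t → HasDerivAt (fun t => γ * (x t - 1) ^ 3 + 3 * V t)
        (3 * γ * (x t - 1) ^ 2 * (x t * (1 - x t) - x t * y t - 1)
          - 3 * ((r - γ) * y t)) t := by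
      intro t ht
      refine (((((hx' t ht).sub_const 1).pow 3).const_mul γ).add
        ((hV' t ht).const_mul 3)).congr_deriv ?_
      push_cast
      ring
    obtain ⟨M, hM⟩ := exists_tendsto_of_hasDerivAt_nonpos (b := -γ) hW'
      (fun t ht => by
        have h₁ : x t * (1 - x t) - x t * y t - 1 ≤ 0 := by
          nlinarith [sq_nonneg (x t - 1), hxpos t ht,
            mul_nonneg (hxpos t ht).le (hynonneg t ht)]
        have h₂ := mul_nonneg (sub_nonneg.2 hγr) (hynonneg t ht)
        have h₃ := mul_nonpos_of_nonneg_of_nonpos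
          (show 0 ≤ 3 * γ * (x t - 1) ^ 2 by positivity) h₁
        linarith)
      (fun t ht => by
        have h₁ : (-1) ^ 3 ≤ (x t - 1) ^ 3 :=
          (Odd.strictMono_pow (by decide)).monotone (by linarith [hxpos t ht])
        nlinarith [hVnonneg t ht, mul_le_mul_of_nonneg_left h₁ hγ.le])
    have hcube : Tendsto (fun t => (x t - 1) ^ 3) atTop (𝓝 ((M - 3 * L) / γ)) := by
      refine ((hM.sub (hL.const_mul 3)).div_const γ).congr fun t => ?_
      field_simp
      ring
    obtain ⟨a, ha⟩ := exists_tendsto_of_tendsto_cube hcube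
    exact ⟨a + 1, (ha.add_const 1).congr fun t => by ring⟩
  have hXpos : 0 < X := by
    refine (Real.exp_pos (-1 - (L + 1) / γ)).trans_le (ge_of_tendsto hX ?_)
    filter_upwards [eventually_ge_atTop 0, hL.eventually_lt_const (lt_add_one L)] with t ht hlt
    rw [← Real.le_log_iff_exp_le (hxpos t ht)]
    have h : x t - 1 - Real.log (x t) ≤ (L + 1) / γ := by
      rw [le_div_iff₀ hγ]
      have := hynonneg t ht
      simp only [hV] at hlt
      linarith
    linarith [hxpos t ht]
  obtain ⟨Y, hY⟩ : ∃ Y, Tendsto y atTop (𝓝 Y) :=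
    ⟨_, (hL.sub (((hX.sub_const 1).sub (hX.log hXpos.ne')).const_mul γ)).congr fun t => by
      simp only [hV]; ring⟩
  have hYnonneg : 0 ≤ Y := ge_of_tendsto hY ((eventually_ge_atTop 0).mono hynonneg)
  have hXeq : X * (1 - X) - X * Y = 0 := by
    refine eq_zero_of_tendsto_of_tendsto_deriv hx hX
      (((hX.mul (hX.const_sub 1)).sub (hX.mul hY)).congr' ?_)
    filter_upwards [eventually_ge_atTop 0] with t ht using (hxode t ht).symm
  have hYeq : γ * X * Y - r * Y = 0 := by
    refine eq_zero_of_tendsto_of_tendsto_deriv hy hY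
      ((((hX.const_mul γ).mul hY).sub (hY.const_mul r)).congr' ?_)
    filter_upwards [eventually_ge_atTop 0] with t ht using (hyode t ht).symm
  have hXY : X = 1 - Y := by
    have h : X * (1 - X - Y) = 0 := by linarith
    rcases mul_eq_zero.1 h with h | h <;> linarith
  have hY0 : Y = 0 := by
    subst hXY
    have h : γ * Y ^ 2 = 0 := by
      nlinarith [mul_nonneg (sub_nonneg.2 hγr) hYnonneg, mul_nonneg hγ.le (sq_nonneg Y)]
    simpa [hγ.ne'] using h
  subst hY0
  rw [sub_zero] at hXY
  subst hXY
  exact hX.prodMk_nhds hY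
end

section
/- Let r, γ be real parameters with 0 < r < γ. Suppose x, y : ℝ → ℝ are differentiable functions satisfying, for all t ≥ 0, x'(t) = x(t)(1 − x(t)) − x(t)y(t) and y'(t) = γ x(t) y(t) − r y(t), and suppose x(t) > 0 and y(t) > 0 for all t ≥ 0. Then (x(t), y(t)) tends to the positive equilibrium E₂ = (r/γ, (γ−r)/γ) as t → ∞. -/
open Filter Topology

/-- The Volterra function `z - 1 - log z`, nonnegative on `(0, ∞)` with its only zero at `1`. -/
noncomputable def volterra (z : ℝ) : ℝ := z - 1 - Real.log z

lemma hasDerivAt_volterra {z : ℝ} (hz : z ≠ 0) : HasDerivAt volterra (1 - z⁻¹) z :=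
  ((hasDerivAt_id z).sub_const 1).sub (Real.hasDerivAt_log hz)

lemma sq_sqrt_sub_one_le_volterra {z : ℝ} (hz : 0 < z) : (√z - 1) ^ 2 ≤ volterra z := by
  have h1 := Real.log_le_sub_one_of_pos (Real.sqrt_pos.2 hz)
  rw [Real.log_sqrt hz.le] at h1
  have h2 := Real.sq_sqrt hz.le
  unfold volterra
  nlinarith

lemma volterra_nonneg {z : ℝ} (hz : 0 < z) : 0 ≤ volterra z :=
  (sq_nonneg _).trans (sq_sqrt_sub_one_le_volterra hz)

lemma le_of_volterra_le {z C : ℝ} (hz : 0 < z) (h : volterra z ≤ C) : z ≤ 2 * C + 2 := by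
  have h1 := sq_sqrt_sub_one_le_volterra hz
  have h2 := Real.sq_sqrt hz.le
  nlinarith [sq_nonneg (√z - 2)]

lemma exp_le_of_volterra_le {z C : ℝ} (hz : 0 < z) (h : volterra z ≤ C) :
    Real.exp (-(C + 1)) ≤ z := by
  rw [← Real.le_log_iff_exp_le hz]
  unfold volterra at h
  linarith

lemma tendsto_one_of_volterra {ι : Type*} {l : Filter ι} {z : ι → ℝ} (hz : ∀ᶠ t in l, 0 < z t)
    (h : Tendsto (fun t => volterra (z t)) l (𝓝 0)) : Tendsto z l (𝓝 1) := by
  have h1 : Tendsto (fun t => (√(z t) - 1) ^ 2) l (𝓝 0) :=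
    tendsto_of_tendsto_of_tendsto_of_le_of_le' tendsto_const_nhds h
      (Eventually.of_forall fun _ => sq_nonneg _)
      (hz.mono fun _ ht => sq_sqrt_sub_one_le_volterra ht)
  have h2 : Tendsto (fun t => √(z t) - 1) l (𝓝 0) := by
    have := h1.sqrt
    simp only [Real.sqrt_sq_eq_abs, Real.sqrt_zero] at this
    exact (tendsto_zero_iff_abs_tendsto_zero _).2 this
  have h3 : Tendsto (fun t => (√(z t) - 1 + 1) ^ 2) l (𝓝 ((0 + 1) ^ 2)) :=
    (h2.add_const 1).pow 2
  norm_num at h3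
  exact h3.congr' (hz.mono fun t ht => Real.sq_sqrt ht.le)

/-- A function bounded below on `[0, ∞)` cannot have its derivative bounded above by a negative
constant. -/
lemma exists_neg_lt_deriv {W W' : ℝ → ℝ} {B c : ℝ} (hc : 0 < c)
    (hW : ∀ t, 0 ≤ t → HasDerivAt W (W' t) t) (hB : ∀ t, 0 ≤ t → B ≤ W t) :
    ∃ t, 0 ≤ t ∧ -c < W' t := by
  by_contra! hneg
  have hT : 0 ≤ (W 0 - B + 1) / c := div_nonneg (by linarith [hB 0 le_rfl]) hc.le
  have hle := (convex_Ici (0 : ℝ)).image_sub_le_mul_sub_of_deriv_le (f := W) (C := -c)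
    (fun t ht => (hW t ht).continuousAt.continuousWithinAt)
    (fun t ht => (hW t (interior_subset ht)).differentiableAt.differentiableWithinAt)
    (fun t ht => by
      rw [(hW t (interior_subset ht)).deriv]
      exact hneg t (interior_subset ht))
    0 Set.self_mem_Ici _ hT hT
  have hcancel : c * ((W 0 - B + 1) / c) = W 0 - B + 1 := by field_simp
  linarith [hB _ hT]

/-- Continuous phytoplankton–zooplankton model, case `0 < r < γ`:
every positive solution converges to the positive equilibrium
`E₂ = (r/γ, (γ−r)/γ)`. -/
theorem continuous_model_global_stability_E2
    (r γ : ℝ) (hr : 0 < r) (hrγ : r < γ)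
    (x y : ℝ → ℝ) (hx : Differentiable ℝ x) (hy : Differentiable ℝ y)
    (hxode : ∀ t : ℝ, 0 ≤ t → deriv x t = x t * (1 - x t) - x t * y t)
    (hyode : ∀ t : ℝ, 0 ≤ t → deriv y t = γ * x t * y t - r * y t)
    (hxpos : ∀ t : ℝ, 0 ≤ t → 0 < x t)
    (hypos : ∀ t : ℝ, 0 ≤ t → 0 < y t) :
    Filter.Tendsto (fun t => (x t, y t)) Filter.atTop
      (nhds ((r / γ : ℝ), ((γ - r) / γ : ℝ))) := by
  have hγ : 0 < γ := hr.trans hrγ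
  obtain ⟨a, ha⟩ : ∃ a, a = r / γ := ⟨_, rfl⟩
  obtain ⟨b, hb⟩ : ∃ b, b = (γ - r) / γ := ⟨_, rfl⟩
  have ha0 : 0 < a := ha ▸ div_pos hr hγ
  have hb0 : 0 < b := hb ▸ div_pos (sub_pos.2 hrγ) hγ
  have hra : r = γ * a := by rw [ha]; field_simp
  have hab : b = 1 - a := by rw [ha, hb]; field_simp
  rw [← ha, ← hb]
  have hx' : ∀ t, 0 ≤ t → HasDerivAt x (-x t * ((x t - a) + (y t - b))) t := fun t ht => by
    refine (hx t).hasDerivAt.congr_deriv ?_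
    rw [hxode t ht, hab]; ring
  have hy' : ∀ t, 0 ≤ t → HasDerivAt y (γ * y t * (x t - a)) t := fun t ht => by
    refine (hy t).hasDerivAt.congr_deriv ?_
    rw [hyode t ht, hra]; ring
  have hxa : ∀ t, 0 ≤ t → 0 < x t / a := fun t ht => div_pos (hxpos t ht) ha0
  have hyb : ∀ t, 0 ≤ t → 0 < y t / b := fun t ht => div_pos (hypos t ht) hb0
  let F : ℝ × ℝ → ℝ := fun p => r * volterra (p.1 / a) + b * volterra (p.2 / b)
  let V : ℝ → ℝ := fun t => F (x t, y t)
  have hV' : ∀ t, 0 ≤ t → HasDerivAt V (-γ * (x t - a) ^ 2) t := fun t ht => by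
    have h1 := ((hasDerivAt_volterra (hxa t ht).ne').comp t ((hx' t ht).div_const a)).const_mul r
    have h2 := ((hasDerivAt_volterra (hyb t ht).ne').comp t ((hy' t ht).div_const b)).const_mul b
    refine (h1.add h2).congr_deriv ?_
    have := (hxpos t ht).ne'
    have := (hypos t ht).ne'
    rw [hra]
    field_simp
    ring
  have hVanti : AntitoneOn V (Set.Ici 0) :=
    antitoneOn_of_deriv_nonpos (convex_Ici 0)
      (fun t ht => (hV' t ht).continuousAt.continuousWithinAt)
      (fun t ht => (hV' t (interior_subset ht)).differentiableAt.differentiableWithinAt)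
      (fun t ht => by
        rw [(hV' t (interior_subset ht)).deriv]
        nlinarith [sq_nonneg (x t - a)])
  have hgx : ∀ t, 0 ≤ t → 0 ≤ volterra (x t / a) ∧ volterra (x t / a) ≤ V t / r :=
    fun t ht => ⟨volterra_nonneg (hxa t ht), by
      rw [le_div_iff₀ hr]
      nlinarith [mul_nonneg hb0.le (volterra_nonneg (hyb t ht))]⟩
  have hgy : ∀ t, 0 ≤ t → 0 ≤ volterra (y t / b) ∧ volterra (y t / b) ≤ V t / b :=
    fun t ht => ⟨volterra_nonneg (hyb t ht), by
      rw [le_div_iff₀ hb0]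
      nlinarith [mul_nonneg hr.le (volterra_nonneg (hxa t ht))]⟩
  have hV0 : ∀ t, 0 ≤ t → 0 ≤ V t := fun t ht =>
    add_nonneg (mul_nonneg hr.le (hgx t ht).1) (mul_nonneg hb0.le (hgy t ht).1)
  have hVle : ∀ t, 0 ≤ t → V t ≤ V 0 := fun t ht => hVanti Set.self_mem_Ici ht ht
  have hgx0 : ∀ t, 0 ≤ t → volterra (x t / a) ≤ V 0 / r := fun t ht =>
    (hgx t ht).2.trans (by gcongr; exact hVle t ht)
  have hgy0 : ∀ t, 0 ≤ t → volterra (y t / b) ≤ V 0 / b := fun t ht =>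
    (hgy t ht).2.trans (by gcongr; exact hVle t ht)
  obtain ⟨m, hm, hmx⟩ : ∃ m, 0 < m ∧ ∀ t, 0 ≤ t → m ≤ x t :=
    ⟨Real.exp (-(V 0 / r + 1)) * a, by positivity, fun t ht =>
      (le_div_iff₀ ha0).1 (exp_le_of_volterra_le (hxa t ht) (hgx0 t ht))⟩
  obtain ⟨M, hxM⟩ : ∃ M, ∀ t, 0 ≤ t → x t ≤ M :=
    ⟨_, fun t ht => (div_le_iff₀ ha0).1 (le_of_volterra_le (hxa t ht) (hgx0 t ht))⟩
  obtain ⟨N, hyN⟩ : ∃ N, ∀ t, 0 ≤ t → y t ≤ N :=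
    ⟨_, fun t ht => (div_le_iff₀ hb0).1 (le_of_volterra_le (hyb t ht) (hgy0 t ht))⟩
  have hM : 0 < M := (hxpos 0 le_rfl).trans_le (hxM 0 le_rfl)
  have hN : 0 < N := (hypos 0 le_rfl).trans_le (hyN 0 le_rfl)
  -- The cross term makes `A * V + (x - a) * (y - b)` a strict Lyapunov function.
  obtain ⟨A, hA⟩ : ∃ A, A = (M / 2 + γ * N + m / 2) / γ := ⟨_, rfl⟩
  have hA0 : 0 ≤ A := by rw [hA]; positivity
  have hAγ : A * γ = M / 2 + γ * N + m / 2 := by rw [hA]; field_simp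
  have hW' : ∀ t, 0 ≤ t → HasDerivAt (fun t => A * V t + (x t - a) * (y t - b))
      (A * (-γ * (x t - a) ^ 2) + (-x t * ((x t - a) + (y t - b)) * (y t - b)
        + (x t - a) * (γ * y t * (x t - a)))) t := fun t ht =>
    ((hV' t ht).const_mul A).add (((hx' t ht).sub_const a).mul ((hy' t ht).sub_const b))
  have hWB : ∀ t, 0 ≤ t → -(M * b + a * N) ≤ A * V t + (x t - a) * (y t - b) := fun t ht => by
    nlinarith [mul_nonneg hA0 (hV0 t ht), mul_pos (hxpos t ht) (hypos t ht), mul_pos ha0 hb0,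
      mul_le_mul_of_nonneg_right (hxM t ht) hb0.le, mul_le_mul_of_nonneg_left (hyN t ht) ha0.le]
  have hclose : ∀ δ > 0, ∃ t, 0 ≤ t ∧ (x t - a) ^ 2 + (y t - b) ^ 2 < δ := fun δ hδ => by
    obtain ⟨t, ht, hlt⟩ := exists_neg_lt_deriv (show 0 < m / 2 * δ by positivity) hW' hWB
    refine ⟨t, ht, lt_of_mul_lt_mul_left ?_ (half_pos hm).le⟩
    have e1 := mul_nonneg (sub_nonneg.2 (hxM t ht)) (sq_nonneg (x t - a))
    have e2 := mul_nonneg (mul_nonneg hγ.le (sub_nonneg.2 (hyN t ht))) (sq_nonneg (x t - a))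
    have e3 := mul_nonneg (sub_nonneg.2 (hmx t ht)) (sq_nonneg (y t - b))
    have e4 := mul_nonneg (hxpos t ht).le (sq_nonneg ((x t - a) + (y t - b)))
    have e5 : A * (-γ * (x t - a) ^ 2) = -(M / 2 + γ * N + m / 2) * (x t - a) ^ 2 := by
      rw [← hAγ]; ring
    rw [e5] at hlt
    nlinarith
  have hFcont : ContinuousAt F (a, b) := by
    have c1 : ContinuousAt volterra (a / a) :=
      (hasDerivAt_volterra (div_pos ha0 ha0).ne').continuousAt
    have c2 : ContinuousAt volterra (b / b) :=
      (hasDerivAt_volterra (div_pos hb0 hb0).ne').continuousAt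
    have d1 : ContinuousAt (fun p : ℝ × ℝ => p.1 / a) (a, b) := by fun_prop
    have d2 : ContinuousAt (fun p : ℝ × ℝ => p.2 / b) (a, b) := by fun_prop
    exact ((ContinuousAt.comp (f := fun p : ℝ × ℝ => p.1 / a) c1 d1).const_mul r).add
      ((ContinuousAt.comp (f := fun p : ℝ × ℝ => p.2 / b) c2 d2).const_mul b)
  have hF0 : F (a, b) = 0 := by simp [F, volterra, ha0.ne', hb0.ne']
  have hVlim : Tendsto V atTop (𝓝 0) := by
    rw [Metric.tendsto_atTop]
    intro ε hε
    obtain ⟨δ, hδ, hball⟩ := Metric.continuousAt_iff.1 hFcont ε hε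
    obtain ⟨T, hT, hlt⟩ := hclose (δ ^ 2) (by positivity)
    have hVT : V T < ε := by
      have hdist : dist (x T, y T) (a, b) < δ := by
        rw [Prod.dist_eq, Real.dist_eq, Real.dist_eq]
        exact max_lt (abs_lt_of_sq_lt_sq (by nlinarith [sq_nonneg (y T - b)]) hδ.le)
          (abs_lt_of_sq_lt_sq (by nlinarith [sq_nonneg (x T - a)]) hδ.le)
      have := hball hdist
      rw [hF0, Real.dist_eq, sub_zero] at this
      exact (le_abs_self _).trans_lt this
    refine ⟨T, fun t ht => ?_⟩
    have ht0 : 0 ≤ t := hT.trans ht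
    rw [Real.dist_eq, sub_zero, abs_of_nonneg (hV0 t ht0)]
    exact (hVanti hT ht0 ht).trans_lt hVT
  have hev : ∀ᶠ t : ℝ in atTop, 0 ≤ t := eventually_ge_atTop 0
  have limx : Tendsto (fun t => x t / a) atTop (𝓝 1) := by
    refine tendsto_one_of_volterra (hev.mono hxa) ?_
    exact tendsto_of_tendsto_of_tendsto_of_le_of_le' tendsto_const_nhds
      (by simpa using hVlim.div_const r) (hev.mono fun t ht => (hgx t ht).1)
      (hev.mono fun t ht => (hgx t ht).2)
  have limy : Tendsto (fun t => y t / b) atTop (𝓝 1) := by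
    refine tendsto_one_of_volterra (hev.mono hyb) ?_
    exact tendsto_of_tendsto_of_tendsto_of_le_of_le' tendsto_const_nhds
      (by simpa using hVlim.div_const b) (hev.mono fun t ht => (hgy t ht).1)
      (hev.mono fun t ht => (hgy t ht).2)
  refine Tendsto.prodMk_nhds ?_ ?_
  · simpa [ha0.ne'] using limx.mul_const a
  · simpa [hb0.ne'] using limy.mul_const b
end

section
/- Fix real parameters r, γ with 0 < r ≤ 1 and γ > 0, and let V(x,y) = (x(2−x) − xy, γxy + (1−r)y). Define 𝓜 = {(x,y) ∈ ℝ² : 0 ≤ x ≤ 1 and 0 ≤ y ≤ 2 − x}. If either (a) 0 < γ ≤ r, or (b) γ > r and 4γ² − 4γ(r+1) + (r−1)² ≤ 0 (equivalently (1−√r)²/2 ≤ γ ≤ (1+√r)²/2 with γ > r), then 𝓜 is invariant under V: for every (x,y) ∈ 𝓜 one has V(x,y) ∈ 𝓜. -/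
/-- Invariance of the set `𝓜 = {(x,y) : 0 ≤ x ≤ 1, 0 ≤ y ≤ 2 − x}` under the
discrete map `V(x,y) = (x(2−x) − xy, γxy + (1−r)y)`, provided `0 < r ≤ 1` and
either `0 < γ ≤ r`, or `γ > r` with `4γ² − 4γ(r+1) + (r−1)² ≤ 0`. -/
theorem invariant_set_M
    (r γ : ℝ) (hr : 0 < r) (hr1 : r ≤ 1) (hγ : 0 < γ)
    (V : ℝ × ℝ → ℝ × ℝ)
    (hV : V = fun p => (p.1 * (2 - p.1) - p.1 * p.2, γ * p.1 * p.2 + (1 - r) * p.2))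
    (hparam : γ ≤ r ∨ (r < γ ∧ 4 * γ ^ 2 - 4 * γ * (r + 1) + (r - 1) ^ 2 ≤ 0)) :
    ∀ p : ℝ × ℝ, p ∈ {q : ℝ × ℝ | 0 ≤ q.1 ∧ q.1 ≤ 1 ∧ 0 ≤ q.2 ∧ q.2 ≤ 2 - q.1} →
      V p ∈ {q : ℝ × ℝ | 0 ≤ q.1 ∧ q.1 ≤ 1 ∧ 0 ≤ q.2 ∧ q.2 ≤ 2 - q.1} := by
  subst hV
  rintro ⟨x, y⟩ ⟨hx0, hx1, hy0, hy⟩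
  dsimp only at hx0 hx1 hy0 hy
  have hx2 : x * (2 - x) ≤ 1 := by nlinarith [sq_nonneg (x - 1)]
  have hgrowth : 0 ≤ γ * x + (1 - r) := by nlinarith [mul_nonneg hγ.le hx0]
  -- On the edge `y = 2 - x` the bound on the coordinate sum is a quadratic inequality in `x`.
  have hedge : (2 - x) * (γ * x + (1 - r)) ≤ 2 := by
    rcases hparam with h | ⟨-, h⟩
    · nlinarith [mul_nonneg (sub_nonneg.2 hr1) hx0, mul_le_mul_of_nonneg_left hx2 hγ.le]
    · have hdisc : 0 ≤ 4 * γ * (2 - (2 - x) * (γ * x + (1 - r))) := by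
        nlinarith [sq_nonneg (2 * γ * x - (2 * γ - 1 + r))]
      linarith [nonneg_of_mul_nonneg_right hdisc (by positivity)]
  refine ⟨?_, ?_, ?_, ?_⟩ <;> dsimp only
  · nlinarith [mul_nonneg hx0 (sub_nonneg.2 hy)]
  · nlinarith [mul_nonneg hx0 hy0]
  · nlinarith [mul_nonneg hgrowth hy0]
  · -- The coordinate sum is affine in `y`, so it suffices to compare with `y = 0` and `y = 2 - x`.
    have hconv : 0 ≤ (2 - x) * (2 - (x * (2 - x) - x * y) - (γ * x * y + (1 - r) * y)) := by
      nlinarith [mul_nonneg hy0 (sub_nonneg.2 hedge),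
        mul_nonneg (sub_nonneg.2 hy) (show 0 ≤ 2 - x * (2 - x) by linarith)]
    linarith [nonneg_of_mul_nonneg_right hconv (by linarith)]
end

section
/- Fix real parameters r, γ with 0 < γ < r ≤ 1, let V(x,y) = (x(2−x) − xy, γxy + (1−r)y), let 𝓜 = {(x,y) : 0 ≤ x ≤ 1, 0 ≤ y ≤ 2 − x}, and for a constant c ≥ 1/(r−γ) define L(x,y) = 1 − x + c·y. Then L(x,y) ≥ 0 on 𝓜, L(1,0) = 0, and for every (x,y) ∈ 𝓜 the difference L(V(x,y)) − L(x,y) = x(x−1) + y(cγx + x − cr) is ≤ 0; moreover it is zero only when (x,y) = (0,0) or x = 1. -/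
/-- The discrete Lyapunov function `L(x,y) = 1 − x + cy` (with `c ≥ 1/(r−γ)`)
for the map `V(x,y) = (x(2−x) − xy, γxy + (1−r)y)` on the invariant set
`𝓜 = {(x,y) : 0 ≤ x ≤ 1, 0 ≤ y ≤ 2 − x}`, in the case `0 < γ < r ≤ 1`. -/
theorem discrete_lyapunov_E1
    (r γ : ℝ) (hγ : 0 < γ) (hγr : γ < r) (hr1 : r ≤ 1)
    (V : ℝ × ℝ → ℝ × ℝ)
    (hV : V = fun p => (p.1 * (2 - p.1) - p.1 * p.2, γ * p.1 * p.2 + (1 - r) * p.2))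
    (c : ℝ) (hc : 1 / (r - γ) ≤ c)
    (L : ℝ × ℝ → ℝ) (hL : ∀ p : ℝ × ℝ, L p = 1 - p.1 + c * p.2) :
    -- L ≥ 0 on 𝓜 and L(1,0) = 0
    (∀ p : ℝ × ℝ, 0 ≤ p.1 → p.1 ≤ 1 → 0 ≤ p.2 → p.2 ≤ 2 - p.1 → 0 ≤ L p) ∧
    (L ((1 : ℝ), (0 : ℝ)) = 0) ∧
    -- ΔL = x(x−1) + y(cγx + x − cr) ≤ 0 on 𝓜
    (∀ p : ℝ × ℝ, 0 ≤ p.1 → p.1 ≤ 1 → 0 ≤ p.2 → p.2 ≤ 2 - p.1 →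
      L (V p) - L p = p.1 * (p.1 - 1) + p.2 * (c * γ * p.1 + p.1 - c * r) ∧
      L (V p) - L p ≤ 0) ∧
    -- ΔL vanishes only at (0,0) or on the line x = 1
    (∀ p : ℝ × ℝ, 0 ≤ p.1 → p.1 ≤ 1 → 0 ≤ p.2 → p.2 ≤ 2 - p.1 →
      L (V p) - L p = 0 → p = ((0 : ℝ), (0 : ℝ)) ∨ p.1 = 1) := by
  have hd : 0 < r - γ := sub_pos.mpr hγr
  have hc0 : 0 < c := (one_div_pos.mpr hd).trans_le hc
  have hcd : 1 ≤ c * (r - γ) := (div_le_iff₀ hd).mp hc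
  have hcr : 0 < c * r := mul_pos hc0 (hγ.trans hγr)
  have diff_eq : ∀ p : ℝ × ℝ,
      L (V p) - L p = p.1 * (p.1 - 1) + p.2 * (c * γ * p.1 + p.1 - c * r) := by
    intro p
    rw [hL, hL, hV]
    ring
  have first_nonpos : ∀ x : ℝ, 0 ≤ x → x ≤ 1 → x * (x - 1) ≤ 0 := fun x h0 h1 =>
    mul_nonpos_of_nonneg_of_nonpos h0 (sub_nonpos.mpr h1)
  have second_nonpos : ∀ x y : ℝ, 0 ≤ x → x ≤ 1 → 0 ≤ y →
      y * (c * γ * x + x - c * r) ≤ 0 := by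
    intro x y h0 h1 hy
    refine mul_nonpos_of_nonneg_of_nonpos hy ?_
    nlinarith [mul_nonneg h0 (sub_nonneg.mpr hcd), mul_nonneg hcr.le (sub_nonneg.mpr h1)]
  refine ⟨?_, ?_, ?_, ?_⟩
  · intro p _ h1 hy _
    rw [hL]
    exact add_nonneg (sub_nonneg.mpr h1) (mul_nonneg hc0.le hy)
  · simp [hL]
  · intro p h0 h1 hy _
    refine ⟨diff_eq p, ?_⟩
    rw [diff_eq]
    exact add_nonpos (first_nonpos _ h0 h1) (second_nonpos _ _ h0 h1 hy)
  · rintro ⟨x, y⟩ h0 h1 hy _ h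
    rw [diff_eq] at h
    dsimp only at h0 h1 hy h ⊢
    have hx : x * (x - 1) = 0 := by
      linarith [first_nonpos x h0 h1, second_nonpos x y h0 h1 hy]
    rcases mul_eq_zero.mp hx with rfl | hx
    · left
      have hyz : y * (c * r) = 0 := by linarith
      rw [(mul_eq_zero.mp hyz).resolve_right hcr.ne']
    · exact Or.inr (sub_eq_zero.mp hx)
end
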